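/- Let f : ℝ^m → ℝ be a C² function with |∇f(x)| < 1 for all x, such that f(x) - |x| → 0 as |x| → ∞ (in particular f(x) > |x| for all x, assumed). Then the gradient map ∇f is surjective onto the open unit ball B^m ⊂ ℝ^m; moreover, for every p ∈ B^m there is a point y with ∇f(y) = p and Hessian ∇²f(y) ≥ 0 (positive semidefinite). -/

import Mathlib

open Filter
open scoped RealInnerProductSpace

theorem second_deriv_nonneg_of_min (g g' : ℝ → ℝ) (c : ℝ)
    (hg : ∀ t, HasDerivAt g (g' t) t) (hc : HasDerivAt g' c 0)
    (hmin : ∀ t, g 0 ≤ g t) : 0 ≤ c := by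
  have h0 : g' 0 = 0 := by
    have : IsLocalMin g 0 := Eventually.of_forall hmin
    exact this.hasDerivAt_eq_zero (hg 0)
  by_contra hneg
  push Not at hneg
  have hs := hasDerivAt_iff_tendsto_slope.1 hc
  have hev := hs.eventually (gt_mem_nhds hneg)
  rw [eventually_nhdsWithin_iff, Metric.eventually_nhds_iff] at hev
  obtain ⟨ε, hε, hev⟩ := hev
  obtain ⟨s, hs, hs'⟩ := exists_hasDerivAt_eq_slope g g' (half_pos hε)
    (fun t _ => (hg t).continuousAt.continuousWithinAt) (fun t _ => hg t)
  have hs1 : 0 < s := hs.1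
  have hs2 : s < ε / 2 := hs.2
  have h1 := @hev s (by rw [Real.dist_eq, sub_zero, abs_of_pos hs1]; linarith)
    (by simpa using hs1.ne')
  rw [slope_def_field, h0, sub_zero, sub_zero, div_neg_iff] at h1
  have h2 : 0 ≤ g' s := by
    rw [hs']
    exact div_nonneg (sub_nonneg.2 (hmin _)) (by linarith)
  rcases h1 with h1 | h1 <;> linarith [h1.1, h1.2]

/-- Surjectivity of the Gauss map of an entire spacelike hypersurface asymptotic to a
light cone: for a `C²` spacelike function `f` with `f x > ‖x‖` and `f x - ‖x‖ → 0`
at infinity, every point `p` of the open unit ball is the gradient of `f` at some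
point `y` where moreover the Hessian of `f` is positive semidefinite. -/
theorem gauss_map_surjective {m : ℕ}
    (f : EuclideanSpace ℝ (Fin m) → ℝ)
    (hf : ContDiff ℝ 2 f)
    (hgrad : ∀ x, ‖gradient f x‖ < 1)
    (hcone : ∀ x, f x > ‖x‖)
    (hALC : Tendsto (fun x => f x - ‖x‖) (cocompact (EuclideanSpace ℝ (Fin m))) (nhds 0)) :
    ∀ p : EuclideanSpace ℝ (Fin m), ‖p‖ < 1 →
      ∃ y, gradient f y = p ∧
        ∀ v : EuclideanSpace ℝ (Fin m), 0 ≤ ⟪fderiv ℝ (gradient f) y v, v⟫ := by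
  intro p hp
  have hdiff : Differentiable ℝ f := hf.differentiable (by norm_num)
  have hgd : Differentiable ℝ (gradient f) := by
    have h1 : Differentiable ℝ (fderiv ℝ f) :=
      (hf.fderiv_right (m := 1) (by norm_num)).differentiable (by norm_num)
    exact (InnerProductSpace.toDual ℝ
      (EuclideanSpace ℝ (Fin m))).symm.toContinuousLinearEquiv.differentiable.comp h1
  have hcont : Continuous (fun x => f x - ⟪p, x⟫) := by
    have := hdiff.continuous
    fun_prop
  have htend : Tendsto (fun x => f x - ⟪p, x⟫)
      (cocompact (EuclideanSpace ℝ (Fin m))) atTop := by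
    have h1 : Tendsto (fun x : EuclideanSpace ℝ (Fin m) => (1 - ‖p‖) * ‖x‖)
        (cocompact _) atTop :=
      (tendsto_norm_cocompact_atTop).const_mul_atTop (by linarith)
    refine tendsto_atTop_mono (fun x => ?_) h1
    have := real_inner_le_norm p x
    have := hcone x
    linarith
  obtain ⟨y, hy⟩ := hcont.exists_forall_le htend
  have hder : ∀ v : EuclideanSpace ℝ (Fin m), ∀ t : ℝ,
      HasDerivAt (fun t : ℝ => f (y + t • v) - ⟪p, y + t • v⟫)
        (⟪gradient f (y + t • v), v⟫ - ⟪p, v⟫) t := by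
    intro v t
    have hl : HasDerivAt (fun t : ℝ => y + t • v) v t := by
      simpa using ((hasDerivAt_id t).smul_const v).const_add y
    have h1 := (hdiff (y + t • v)).hasGradientAt.hasFDerivAt.comp_hasDerivAt t hl
    have h2 := (innerSL ℝ p).hasFDerivAt.comp_hasDerivAt t hl
    exact h1.sub h2
  have hmin : ∀ v : EuclideanSpace ℝ (Fin m), ∀ t : ℝ,
      f (y + (0 : ℝ) • v) - ⟪p, y + (0 : ℝ) • v⟫ ≤ f (y + t • v) - ⟪p, y + t • v⟫ := by
    intro v t
    simpa using hy (y + t • v)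
  refine ⟨y, ?_, fun v => ?_⟩
  · refine ext_inner_right ℝ fun v => ?_
    have hm : IsLocalMin (fun t : ℝ => f (y + t • v) - ⟪p, y + t • v⟫) 0 :=
      Eventually.of_forall (hmin v)
    have := hm.hasDerivAt_eq_zero (hder v 0)
    simp only [zero_smul, add_zero] at this
    linarith
  · refine second_deriv_nonneg_of_min _ _ _ (hder v) ?_ (hmin v)
    have hl : HasDerivAt (fun t : ℝ => y + t • v) v 0 := by
      simpa using ((hasDerivAt_id (0 : ℝ)).smul_const v).const_add y
    have h1 : HasDerivAt (fun t : ℝ => gradient f (y + t • v))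
        (fderiv ℝ (gradient f) y v) 0 := by
      have h3 : HasFDerivAt (gradient f) (fderiv ℝ (gradient f) y) (y + (0 : ℝ) • v) := by
        simpa using (hgd y).hasFDerivAt
      exact h3.comp_hasDerivAt (0 : ℝ) hl
    have h2 := h1.inner ℝ (hasDerivAt_const (0 : ℝ) v)
    simpa using h2.sub_const ⟪p, v⟫
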